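/- arXiv:0904.4514 — 4 statements merged into one kernel-verified Lean document; each statement's English description precedes it below -/
import Mathlib

section
/- For all integers N, p with 1 ≤ p ≤ N, one has 1 − ∑_{n=1}^{N−p} β_{N,p}(n)·2^{−n} = ∑_{n=0}^{N−p} β_{N,p}(n)·((p+n)/N)·2^{−n}. -/
open Finset

/-- The recursion satisfied by the summands `β(n) 2^{-n}`. -/
theorem beta_term_succ {N p k : ℕ} (hN : 0 < N) (hk : p + k < N) :
    ((Nat.factorial (N - p) : ℝ) / (Nat.factorial (N - p - k) * (N : ℝ) ^ k)) * (2 : ℝ)⁻¹ ^ k *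
        (1 - ((p : ℝ) + k) / N)
      = 2 * (((Nat.factorial (N - p) : ℝ) /
          (Nat.factorial (N - p - (k + 1)) * (N : ℝ) ^ (k + 1))) * (2 : ℝ)⁻¹ ^ (k + 1)) := by
  obtain ⟨m, rfl⟩ : ∃ m, N = p + k + m + 1 := ⟨N - (p + k + 1), by omega⟩
  have h₁ : p + k + m + 1 - p - k = m + 1 := by omega
  have h₂ : p + k + m + 1 - p - (k + 1) = m := by omega
  have hN' : ((p + k + m + 1 : ℕ) : ℝ) ≠ 0 := by positivity
  have hm : (Nat.factorial m : ℝ) ≠ 0 := by positivity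
  rw [h₁, h₂, Nat.factorial_succ]
  generalize (Nat.factorial (p + k + m + 1 - p) : ℝ) = a
  push_cast at hN' ⊢
  field_simp
  ring

/-- Partial sums of the right-hand side of `beta_identity`. -/
theorem sum_range_beta {N p : ℕ} (hN : 0 < N) (k : ℕ) (hk : p + k ≤ N) :
    ∑ n ∈ Finset.range k,
        ((Nat.factorial (N - p) : ℝ) / (Nat.factorial (N - p - n) * (N : ℝ) ^ n)) *
          (((p : ℝ) + (n : ℝ)) / (N : ℝ)) * (2 : ℝ)⁻¹ ^ n
      = 1 - ∑ n ∈ Finset.Icc 1 k,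
          ((Nat.factorial (N - p) : ℝ) / (Nat.factorial (N - p - n) * (N : ℝ) ^ n)) * (2 : ℝ)⁻¹ ^ n
        - ((Nat.factorial (N - p) : ℝ) / (Nat.factorial (N - p - k) * (N : ℝ) ^ k)) *
          (2 : ℝ)⁻¹ ^ k := by
  induction k with
  | zero => simp [Nat.factorial_ne_zero]
  | succ k ih =>
    rw [Finset.sum_range_succ, ih (by omega), Finset.sum_Icc_succ_top (by omega)]
    linear_combination -beta_term_succ hN (show p + k < N by omega)

/-- Identity (eq. beta) of Appendix C of the paper: with
`β_{N,p}(n) = (N-p)! / ((N-p-n)! N^n)`, for `1 ≤ p ≤ N`,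
`1 - ∑_{n=1}^{N-p} β_{N,p}(n) 2^{-n} = ∑_{n=0}^{N-p} β_{N,p}(n) ((p+n)/N) 2^{-n}`. -/
theorem beta_identity (N p : ℕ) (hp : 1 ≤ p) (hpN : p ≤ N) :
    1 - ∑ n ∈ Finset.Icc 1 (N - p),
        ((Nat.factorial (N - p) : ℝ) / (Nat.factorial (N - p - n) * (N : ℝ) ^ n)) * (2 : ℝ)⁻¹ ^ n
      = ∑ n ∈ Finset.range (N - p + 1),
        ((Nat.factorial (N - p) : ℝ) / (Nat.factorial (N - p - n) * (N : ℝ) ^ n)) *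
          (((p : ℝ) + (n : ℝ)) / (N : ℝ)) * (2 : ℝ)⁻¹ ^ n := by
  have hN : (N : ℝ) ≠ 0 := by exact_mod_cast (show N ≠ 0 by omega)
  rw [Finset.sum_range_succ, sum_range_beta (by omega) _ (by omega), Nat.cast_sub hpN,
    add_sub_cancel, div_self hN]
  ring
end

section
/- For all integers N, p with 1 ≤ p ≤ N, one has 1 − ∑_{n=1}^{N−p} β_{N,p}(n)·2^{−n} ≤ 2(p+1)/N. -/
open Finset

/-- A falling factorial divided by a power is at most one. -/
theorem descFactorial_div_pow_le_one {M N : ℕ} (h : M ≤ N) (n : ℕ) :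
    (M.descFactorial n : ℝ) / (N : ℝ) ^ n ≤ 1 := by
  refine div_le_one_of_le₀ ?_ (by positivity)
  exact_mod_cast (Nat.descFactorial_le_pow M n).trans (Nat.pow_le_pow_left h n)

/-- Weierstrass product inequality for `∏ k < n, (1 - (p + k) / (M + p))`. -/
theorem one_sub_le_descFactorial_div_pow (M p : ℕ) (hN : 0 < M + p) {n : ℕ} (hn : n ≤ M) :
    1 - ((n : ℝ) * p + n * (n - 1) / 2) / ((M + p : ℕ) : ℝ)
      ≤ (M.descFactorial n : ℝ) / ((M + p : ℕ) : ℝ) ^ n := by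
  have hN' : (0 : ℝ) < ((M + p : ℕ) : ℝ) := by exact_mod_cast hN
  induction n with
  | zero => simp
  | succ n ih =>
    have hle := descFactorial_div_pow_le_one (Nat.le_add_right M p) n
    have hstep : (M.descFactorial (n + 1) : ℝ) / ((M + p : ℕ) : ℝ) ^ (n + 1)
        = (M.descFactorial n : ℝ) / ((M + p : ℕ) : ℝ) ^ n
          - (M.descFactorial n : ℝ) / ((M + p : ℕ) : ℝ) ^ n
            * (((p : ℝ) + n) / ((M + p : ℕ) : ℝ)) := by
      rw [Nat.descFactorial_succ, Nat.cast_mul, Nat.cast_sub (by omega)]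
      field_simp
      push_cast
      ring
    have hdrop := mul_le_mul_of_nonneg_right hle
      (show 0 ≤ ((p : ℝ) + n) / ((M + p : ℕ) : ℝ) by positivity)
    have hquad : 1 - (((n + 1 : ℕ) : ℝ) * p + ((n + 1 : ℕ) : ℝ) * (((n + 1 : ℕ) : ℝ) - 1) / 2)
          / ((M + p : ℕ) : ℝ)
        = 1 - ((n : ℝ) * p + n * (n - 1) / 2) / ((M + p : ℕ) : ℝ)
          - ((p : ℝ) + n) / ((M + p : ℕ) : ℝ) := by
      rw [Nat.cast_succ]
      ring
    rw [hstep, hquad]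
    linarith [ih (by omega)]

/-- Closed form of the partial sums of a quadratic polynomial against `2⁻ⁿ`. -/
theorem sum_quadratic_mul_two_inv_pow (p N : ℝ) (m : ℕ) :
    ∑ n ∈ Finset.Icc 1 m, (1 - ((n : ℝ) * p + n * (n - 1) / 2) / N) * (2 : ℝ)⁻¹ ^ n
      = 1 - 2 * (p + 1) / N
        - (1 - (p * (m + 2) + ((m : ℝ) ^ 2 + 3 * m + 4) / 2) / N) * (2 : ℝ)⁻¹ ^ m := by
  induction m with
  | zero => simp; ring
  | succ m ih =>
    rw [Finset.sum_Icc_succ_top (by omega), ih]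
    push_cast
    ring

/-- Lemma numberseq2 of Appendix C of the paper: with
`β_{N,p}(n) = (N-p)! / ((N-p-n)! N^n)`, for `1 ≤ p ≤ N`,
`1 - ∑_{n=1}^{N-p} β_{N,p}(n) 2^{-n} ≤ 2(p+1)/N`. -/
theorem beta_sum_bound (N p : ℕ) (hp : 1 ≤ p) (hpN : p ≤ N) :
    1 - ∑ n ∈ Finset.Icc 1 (N - p),
        ((Nat.factorial (N - p) : ℝ) / (Nat.factorial (N - p - n) * (N : ℝ) ^ n)) * (2 : ℝ)⁻¹ ^ n
      ≤ 2 * ((p : ℝ) + 1) / (N : ℝ) := by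
  obtain ⟨M, rfl⟩ := Nat.exists_eq_add_of_le' hpN
  have hN : 0 < M + p := by omega
  have hN' : (0 : ℝ) < ((M + p : ℕ) : ℝ) := by exact_mod_cast hN
  rw [Nat.add_sub_cancel]
  have hsum : ∑ n ∈ Finset.Icc 1 M,
        (1 - ((n : ℝ) * p + n * (n - 1) / 2) / ((M + p : ℕ) : ℝ)) * (2 : ℝ)⁻¹ ^ n
      ≤ ∑ n ∈ Finset.Icc 1 M, ((Nat.factorial M : ℝ) /
        (Nat.factorial (M - n) * ((M + p : ℕ) : ℝ) ^ n)) * (2 : ℝ)⁻¹ ^ n := by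
    refine Finset.sum_le_sum fun n hn => mul_le_mul_of_nonneg_right ?_ (by positivity)
    have hnM := (Finset.mem_Icc.mp hn).2
    refine (one_sub_le_descFactorial_div_pow M p hN hnM).trans_eq ?_
    rw [← Nat.factorial_mul_descFactorial hnM, Nat.cast_mul,
      mul_div_mul_left _ _ (Nat.cast_ne_zero.mpr (Nat.factorial_ne_zero _))]
  rw [sum_quadratic_mul_two_inv_pow] at hsum
  have htail : 1 - ((p : ℝ) * (M + 2) + ((M : ℝ) ^ 2 + 3 * M + 4) / 2) / ((M + p : ℕ) : ℝ)
      ≤ 0 := by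
    rw [sub_nonpos, one_le_div hN']
    push_cast
    have hpM : 0 ≤ (p : ℝ) * M := by positivity
    nlinarith [sq_nonneg (M : ℝ), (Nat.cast_nonneg M : (0 : ℝ) ≤ M),
      (Nat.cast_nonneg p : (0 : ℝ) ≤ p)]
  linarith [mul_nonpos_of_nonpos_of_nonneg htail
    (show (0 : ℝ) ≤ (2 : ℝ)⁻¹ ^ M by positivity)]
end

section
/- For all integers N, p, L with 1 ≤ p, 1 ≤ L ≤ N − p, one has ∑_{n=0}^{L−1} (1 − β_{N,p}(n))·2^{p−1−n} + ∑_{n=L}^∞ 2^{p−n−1} ≤ 2^p·(p+1)/N + 2^{p−L}. -/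
open Finset

theorem one_sub_descFactorial_div_pow_le {M p N : ℕ} (hN : 0 < N) (h : M + p = N) (n : ℕ) :
    1 - (M.descFactorial n : ℝ) / (N : ℝ) ^ n ≤ (n * p + n * (n - 1) / 2) / N := by
  have hN' : (0 : ℝ) < N := by exact_mod_cast hN
  have h' : (M : ℝ) + p = N := by exact_mod_cast h
  induction n with
  | zero => simp
  | succ n ih =>
    have hle : (M.descFactorial n : ℝ) / (N : ℝ) ^ n ≤ 1 := by
      rw [div_le_one (by positivity)]
      exact_mod_cast (Nat.descFactorial_le_pow M n).trans (Nat.pow_le_pow_left (by omega) n)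
    have hnonneg : (0 : ℝ) ≤ (M.descFactorial n : ℝ) / (N : ℝ) ^ n := by positivity
    have hsub : (M : ℝ) - n ≤ ((M - n : ℕ) : ℝ) := by
      rw [sub_le_iff_le_add]
      exact_mod_cast (by omega : M ≤ M - n + n)
    have hstep : (M.descFactorial (n + 1) : ℝ) / (N : ℝ) ^ (n + 1)
        = (M.descFactorial n : ℝ) / (N : ℝ) ^ n * (((M - n : ℕ) : ℝ) / N) := by
      rw [Nat.descFactorial_succ, pow_succ]
      push_cast
      field_simp
    have hfactor : 1 - ((p : ℝ) + n) / N ≤ ((M - n : ℕ) : ℝ) / N := by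
      rw [one_sub_div hN'.ne']
      gcongr
      linarith
    have hdrop : (M.descFactorial n : ℝ) / (N : ℝ) ^ n - ((p : ℝ) + n) / N
        ≤ (M.descFactorial (n + 1) : ℝ) / (N : ℝ) ^ (n + 1) := by
      rw [hstep]
      have := mul_le_mul_of_nonneg_left hfactor hnonneg
      have : (M.descFactorial n : ℝ) / (N : ℝ) ^ n * (((p : ℝ) + n) / N) ≤ ((p : ℝ) + n) / N :=
        mul_le_of_le_one_left (by positivity) hle
      linarith
    have hsum : (((n + 1 : ℕ) : ℝ) * p + ((n + 1 : ℕ) : ℝ) * (((n + 1 : ℕ) : ℝ) - 1) / 2) / N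
        = (n * p + n * (n - 1) / 2) / N + ((p : ℝ) + n) / N := by
      push_cast
      ring
    linarith

theorem sum_range_quadratic_mul_half_pow (p : ℝ) (L : ℕ) :
    ∑ n ∈ range L, (n * p + n * (n - 1) / 2) * (1 / 2 : ℝ) ^ (n + 1)
      = p + 1 - (L * p + L * (L - 1) / 2 + p + L + 1) * (1 / 2 : ℝ) ^ L := by
  induction L with
  | zero => simp
  | succ L ih =>
    rw [sum_range_succ, ih]
    push_cast
    ring

theorem two_zpow_sub_natCast (k : ℤ) (n : ℕ) :
    (2 : ℝ) ^ (k - n) = 2 ^ k * (1 / 2 : ℝ) ^ n := by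
  rw [zpow_sub₀ two_ne_zero, zpow_natCast, one_div, inv_pow, div_eq_mul_inv]

theorem tsum_two_zpow_sub (k : ℤ) : ∑' m : ℕ, (2 : ℝ) ^ (k - m - 1) = 2 ^ k := by
  have h (m : ℕ) : (2 : ℝ) ^ (k - m - 1) = 2 ^ (k - 1) * (1 / 2 : ℝ) ^ m := by
    rw [sub_right_comm, two_zpow_sub_natCast]
  simp_rw [h]
  rw [tsum_mul_left, tsum_geometric_two, zpow_sub_one₀ two_ne_zero]
  ring

/-- The bound `S_{p,N,L} ≤ 2^p (p+1)/N + 2^{p-L}` from Section 6 of the paper: with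
`β_{N,p}(n) = (N-p)! / ((N-p-n)! N^n)`, for `p ≥ 1` and `1 ≤ L ≤ N - p`,
`∑_{n=0}^{L-1} (1 - β_{N,p}(n)) 2^{p-1-n} + ∑_{n=L}^∞ 2^{p-n-1} ≤ 2^p (p+1)/N + 2^{p-L}`. -/
theorem S_pNL_bound (N p L : ℕ) (hp : 1 ≤ p) (hL : 1 ≤ L) (hLN : L ≤ N - p) :
    (∑ n ∈ Finset.range L,
        (1 - (Nat.factorial (N - p) : ℝ) / (Nat.factorial (N - p - n) * (N : ℝ) ^ n)) *
          (2 : ℝ) ^ ((p : ℤ) - 1 - (n : ℤ)))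
      + (∑' m : ℕ, (2 : ℝ) ^ ((p : ℤ) - ((L : ℤ) + (m : ℤ)) - 1))
      ≤ (2 : ℝ) ^ (p : ℤ) * ((p : ℝ) + 1) / (N : ℝ) + (2 : ℝ) ^ ((p : ℤ) - (L : ℤ)) := by
  have hN : 0 < N := by omega
  simp_rw [← sub_sub (p : ℤ) (L : ℤ)]
  rw [tsum_two_zpow_sub]
  gcongr
  calc _ ≤ ∑ n ∈ range L, (2 : ℝ) ^ (p : ℤ) / N *
          ((n * p + n * (n - 1) / 2) * (1 / 2 : ℝ) ^ (n + 1)) := by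
        refine sum_le_sum fun n hn => ?_
        have hnM : n ≤ N - p := (mem_range.mp hn).le.trans hLN
        have hfac : ((N - p).factorial : ℝ) / ((N - p - n).factorial * (N : ℝ) ^ n)
            = ((N - p).descFactorial n : ℝ) / (N : ℝ) ^ n := by
          rw [← Nat.factorial_mul_descFactorial hnM, Nat.cast_mul]
          exact mul_div_mul_left _ _ (by positivity)
        have hpow : (2 : ℝ) ^ ((p : ℤ) - 1 - n) = 2 ^ (p : ℤ) * (1 / 2 : ℝ) ^ (n + 1) := by
          rw [← two_zpow_sub_natCast]
          congr 1
          push_cast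
          ring
        rw [hfac, hpow]
        refine (mul_le_mul_of_nonneg_right
          (one_sub_descFactorial_div_pow_le hN (by omega : N - p + p = N) n)
          (by positivity)).trans_eq ?_
        ring
    _ ≤ (2 : ℝ) ^ (p : ℤ) / N * (p + 1) := by
        rw [← mul_sum, sum_range_quadratic_mul_half_pow]
        have hL' : (1 : ℝ) ≤ L := by exact_mod_cast hL
        have hL'' : (0 : ℝ) ≤ L - 1 := by linarith
        gcongr
        exact sub_le_self _ (by positivity)
    _ = _ := by ring
end

section
/- Let k, p, N, L be integers with k ≥ 2, p ≥ 1, N ≥ 1, L ≥ 0, and let Σ be a real number. For an integer q ≥ 1 define R_q := 2^{k·q}·(2^{Σ}·q/N + 2^{−k·L}). Then ∑_{n=0}^{L−1} R_{p+n}·2^{p−1−n} ≤ 2^{(k+1)p−1}·(2^{Σ + k·L}·p/N + 2^{−L}). -/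
open Finset

theorem sum_range_pow_le_pow {r : ℝ} (hr : 2 ≤ r) (L : ℕ) :
    ∑ n ∈ Finset.range L, r ^ n ≤ r ^ L := by
  induction L with
  | zero => simp
  | succ L ih =>
    rw [Finset.sum_range_succ, pow_succ]
    nlinarith [pow_nonneg (by linarith : (0 : ℝ) ≤ r) L]

theorem add_natCast_le_mul_two_pow {p n L : ℕ} (hp : 1 ≤ p) (hn : n < L) :
    (p : ℝ) + n ≤ p * 2 ^ L := by
  have hL : L + 1 ≤ 2 ^ L := Nat.lt_two_pow_self
  have h : p + n ≤ p * 2 ^ L := by nlinarith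
  exact_mod_cast h

/-- The key arithmetic estimate of the induction step in Section 6 of the paper
(the chain of inequalities proving eq. remstep): for integers `k ≥ 2`, `p ≥ 1`,
`N ≥ 1`, `L ≥ 0` and a real number `Σ`, with `R_q = 2^{kq} (2^Σ q/N + 2^{-kL})`,
`∑_{n=0}^{L-1} R_{p+n} 2^{p-1-n} ≤ 2^{(k+1)p-1} (2^{Σ+kL} p/N + 2^{-L})`. -/
theorem induction_step_arith (k p N L : ℕ) (hk : 2 ≤ k) (hp : 1 ≤ p) (hN : 1 ≤ N) (S : ℝ) :
    ∑ n ∈ Finset.range L,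
        ((2 : ℝ) ^ (k * (p + n)) *
          ((2 : ℝ) ^ S * ((p : ℝ) + (n : ℝ)) / (N : ℝ) + (2 : ℝ) ^ (-((k : ℤ) * (L : ℤ))))) *
          (2 : ℝ) ^ ((p : ℤ) - 1 - (n : ℤ))
      ≤ (2 : ℝ) ^ (((k : ℤ) + 1) * (p : ℤ) - 1) *
          ((2 : ℝ) ^ (S + (k : ℝ) * (L : ℝ)) * (p : ℝ) / (N : ℝ) + (2 : ℝ) ^ (-(L : ℤ))) := by
  obtain ⟨m, rfl⟩ : ∃ m, k = m + 1 := ⟨k - 1, by omega⟩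
  have h2 : (2 : ℝ) ≠ 0 := two_ne_zero
  have hN' : (0 : ℝ) < N := by exact_mod_cast hN
  set C : ℝ := (2 : ℝ) ^ ((((m + 1 : ℕ) : ℤ) + 1) * (p : ℤ) - 1) with hC
  set D : ℝ := (2 : ℝ) ^ (-(((m + 1 : ℕ) : ℤ) * (L : ℤ))) with hD
  have hr : (2 : ℝ) ≤ 2 ^ m := le_self_pow₀ one_le_two (by omega)
  have hterm : ∀ n ∈ Finset.range L,
      ((2 : ℝ) ^ ((m + 1) * (p + n)) * ((2 : ℝ) ^ S * ((p : ℝ) + (n : ℝ)) / (N : ℝ) + D)) *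
          (2 : ℝ) ^ ((p : ℤ) - 1 - (n : ℤ)) ≤
        C * ((2 : ℝ) ^ S * (p * 2 ^ L) / N + D) * (2 ^ m) ^ n := by
    intro n hn
    have hpow : (2 : ℝ) ^ ((m + 1) * (p + n)) * (2 : ℝ) ^ ((p : ℤ) - 1 - (n : ℤ)) =
        C * (2 ^ m) ^ n := by
      rw [hC, ← pow_mul, ← zpow_natCast, ← zpow_natCast, ← zpow_add₀ h2, ← zpow_add₀ h2]
      congr 1
      push_cast
      ring
    rw [mul_right_comm, hpow, mul_right_comm C]
    gcongr
    exact add_natCast_le_mul_two_pow hp (Finset.mem_range.mp hn)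
  have hS : (2 : ℝ) ^ (S + ((m + 1 : ℕ) : ℝ) * (L : ℝ)) = 2 ^ S * (2 ^ L * (2 ^ m) ^ L) := by
    rw [Real.rpow_add two_pos, ← Nat.cast_mul, Real.rpow_natCast, ← pow_mul, ← pow_add]
    congr 2
    ring
  have hDL : D * (2 ^ m) ^ L = (2 : ℝ) ^ (-(L : ℤ)) := by
    rw [hD, ← pow_mul, ← zpow_natCast, ← zpow_add₀ h2]
    congr 1
    push_cast
    ring
  calc
    _ ≤ ∑ n ∈ Finset.range L, C * ((2 : ℝ) ^ S * (p * 2 ^ L) / N + D) * (2 ^ m) ^ n :=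
      Finset.sum_le_sum hterm
    _ ≤ C * ((2 : ℝ) ^ S * (p * 2 ^ L) / N + D) * (2 ^ m) ^ L := by
      rw [← Finset.mul_sum]
      gcongr
      exact sum_range_pow_le_pow hr L
    _ = _ := by
      rw [hS, ← hDL]
      ring
end
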